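/- Let c ∈ ℂ be such that θ₁(c+s) ≠ 0 and θ₁(c+s−t_a) ≠ 0 for every s ∈ [0,1] and every a, and suppose θ₁(t_a) ≠ 0 for all a and θ₁(t_a−t_b) ≠ 0 for all a ≠ b. Then the Hitchin Hamiltonian satisfies (1/2)·∫₀¹ Tr(Φ(c+s)²) ds = (1/2)·Σ_{a} κ_a² + (1/2)·Σ_{a≠b} C_{ab}·C_{ba}·℘(t_a−t_b). -/

import Mathlib

/-- The Jacobi theta function `θ₁(z|τ)`, defined from the two-variable Jacobi theta
function: `θ₁(z) = -i · exp(iπτ/4 + iπz) · Θ₂(z + (1+τ)/2)`. -/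
noncomputable def theta1 (τ z : ℂ) : ℂ :=
  -Complex.I * Complex.exp (Real.pi * Complex.I * τ / 4 + Real.pi * Complex.I * z) *
    jacobiTheta₂ (z + (1 + τ) / 2) τ

/-- The second logarithmic derivative `℘(z) = (θ₁''(z)θ₁(z) - θ₁'(z)²)/θ₁(z)²`. -/
noncomputable def wp (τ z : ℂ) : ℂ :=
  (deriv (deriv (theta1 τ)) z * theta1 τ z - (deriv (theta1 τ) z) ^ 2) / (theta1 τ z) ^ 2

/-- The diagonal matrix `Θ(p) = diag(θ₁(p-t_a)/θ₁(t_a))`. -/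
noncomputable def ThetaDiag (τ : ℂ) (n : ℕ) (t : Fin n → ℂ) (p : ℂ) :
    Matrix (Fin n) (Fin n) ℂ :=
  Matrix.diagonal fun a => theta1 τ (p - t a) / theta1 τ (t a)

/-- The diagonal-free matrix `F(p)` with off-diagonal entries
`F_{ab}(p) = C_{ab} θ₁(p+t_a-t_b) θ₁'(0) / (θ₁(t_b-t_a) θ₁(p))`. -/
noncomputable def FMat (τ : ℂ) (n : ℕ) (t : Fin n → ℂ) (C : Matrix (Fin n) (Fin n) ℂ)
    (p : ℂ) : Matrix (Fin n) (Fin n) ℂ :=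
  Matrix.of fun a b =>
    if a = b then 0 else
      C a b * theta1 τ (p + t a - t b) * deriv (theta1 τ) 0 /
        (theta1 τ (t b - t a) * theta1 τ p)

/-- The elliptic framed Higgs field `Φ(p) = H⁻¹ (K + Θ(p) F(p) Θ(p)⁻¹) H`. -/
noncomputable def PhiEll (τ : ℂ) (n : ℕ) (κ t : Fin n → ℂ)
    (C H : Matrix (Fin n) (Fin n) ℂ) (p : ℂ) : Matrix (Fin n) (Fin n) ℂ :=
  H⁻¹ * (Matrix.diagonal κ + ThetaDiag τ n t p * FMat τ n t C p * (ThetaDiag τ n t p)⁻¹) * H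

open scoped Real
open Complex (I)

/-- A sum over `ℤ × ℤ` split according to the parity of the sum of the coordinates. -/
lemma tsum_int_prod_eq_add_parity {f : ℤ × ℤ → ℂ} (hf : Summable f) :
    ∑' p, f p = ∑' p : ℤ × ℤ, f (p.1 + p.2, p.1 - p.2) +
      ∑' p : ℤ × ℤ, f (p.1 + p.2 + 1, p.1 - p.2) := by
  set g₀ : ℤ × ℤ → ℤ × ℤ := fun p => (p.1 + p.2, p.1 - p.2) with hg₀
  set g₁ : ℤ × ℤ → ℤ × ℤ := fun p => (p.1 + p.2 + 1, p.1 - p.2) with hg₁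
  have inj₀ : Function.Injective g₀ := by
    rintro ⟨a, b⟩ ⟨c, d⟩ h
    simp only [hg₀, Prod.mk.injEq] at h ⊢
    omega
  have inj₁ : Function.Injective g₁ := by
    rintro ⟨a, b⟩ ⟨c, d⟩ h
    simp only [hg₁, Prod.mk.injEq] at h ⊢
    omega
  have hcompl : IsCompl (Set.range g₀) (Set.range g₁) := by
    refine IsCompl.of_eq (Set.eq_empty_of_forall_notMem ?_) (Set.eq_univ_of_forall ?_)
    · rintro _ ⟨⟨⟨a, b⟩, rfl⟩, ⟨⟨c, d⟩, h⟩⟩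
      simp only [hg₀, hg₁, Prod.mk.injEq] at h
      omega
    · rintro ⟨m, n⟩
      rcases Int.even_or_odd' (m + n) with ⟨k, hk | hk⟩
      · exact Or.inl ⟨(k, m - k), by simp only [hg₀, Prod.mk.injEq]; omega⟩
      · exact Or.inr ⟨(k, m - k - 1), by simp only [hg₁, Prod.mk.injEq]; omega⟩
  have h₀ := (inj₀.hasSum_range_iff (f := f)).2 (hf.comp_injective inj₀).hasSum
  have h₁ := (inj₁.hasSum_range_iff (f := f)).2 (hf.comp_injective inj₁).hasSum
  exact (h₀.add_isCompl hcompl h₁).tsum_eq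

/-- The product of two theta functions of modulus `τ` in terms of modulus `2 * τ`. -/
lemma jacobiTheta₂_mul_jacobiTheta₂ {τ : ℂ} (hτ : 0 < τ.im) (z w : ℂ) :
    jacobiTheta₂ z τ * jacobiTheta₂ w τ =
      jacobiTheta₂ (z + w) (2 * τ) * jacobiTheta₂ (z - w) (2 * τ) +
        Complex.exp (π * I * τ + 2 * π * I * z) *
          (jacobiTheta₂ (z + w + τ) (2 * τ) * jacobiTheta₂ (z - w + τ) (2 * τ)) := by
  have hτ2 : 0 < (2 * τ).im := by simpa using hτ
  have hs : ∀ {σ : ℂ}, 0 < σ.im → ∀ v, Summable fun n : ℤ => ‖jacobiTheta₂_term n v σ‖ :=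
    fun hσ v => ((summable_jacobiTheta₂_term_iff v _).2 hσ).norm
  simp only [jacobiTheta₂]
  rw [tsum_mul_tsum_of_summable_norm (hs hτ z) (hs hτ w),
    tsum_mul_tsum_of_summable_norm (hs hτ2 _) (hs hτ2 _),
    tsum_mul_tsum_of_summable_norm (hs hτ2 _) (hs hτ2 _),
    tsum_int_prod_eq_add_parity (summable_mul_of_summable_norm (hs hτ z) (hs hτ w)),
    ← tsum_mul_left]
  congr 1
  · refine tsum_congr fun p => ?_
    simp only [jacobiTheta₂_term, ← Complex.exp_add]
    congr 1
    push_cast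
    ring
  · refine tsum_congr fun p => ?_
    simp only [jacobiTheta₂_term, ← Complex.exp_add]
    congr 1
    push_cast
    ring

/-- The theta function `∑ exp(iπτp²/2 + 2πipz)` over even integers `p`. -/
noncomputable def thetaEven (τ z : ℂ) : ℂ := jacobiTheta₂ (2 * z) (2 * τ)

/-- The theta function `∑ exp(iπτp²/2 + 2πipz)` over odd integers `p`. -/
noncomputable def thetaOdd (τ z : ℂ) : ℂ :=
  Complex.exp (π * I * τ / 2 + 2 * π * I * z) * jacobiTheta₂ (2 * z + τ) (2 * τ)

/-- Addition formula: `θ₁(x+y)θ₁(x-y)` is an antisymmetric form of rank two. -/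
lemma theta1_add_mul_theta1_sub {τ : ℂ} (hτ : 0 < τ.im) (x y : ℂ) :
    theta1 τ (x + y) * theta1 τ (x - y) =
      thetaEven τ x * thetaOdd τ y - thetaOdd τ x * thetaEven τ y := by
  have key := jacobiTheta₂_mul_jacobiTheta₂ hτ (x + y + (1 + τ) / 2) (x - y + (1 + τ) / 2)
  have e1 : x + y + (1 + τ) / 2 + (x - y + (1 + τ) / 2) = 2 * x + τ + 1 := by ring
  have e2 : x + y + (1 + τ) / 2 - (x - y + (1 + τ) / 2) = 2 * y := by ring
  have e3 : 2 * x + τ + 1 + τ = 2 * x + 2 * τ + 1 := by ring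
  rw [e1, e2, e3, jacobiTheta₂_add_left, jacobiTheta₂_add_left, jacobiTheta₂_add_left'] at key
  have hE : Complex.exp (π * I * τ / 4 + π * I * (x + y)) * Complex.exp (π * I * τ / 4 + π * I * (x - y)) =
      Complex.exp (π * I * τ / 2 + 2 * π * I * x) := by
    rw [← Complex.exp_add]; congr 1; ring
  have hE2 : Complex.exp (π * I * τ / 2 + 2 * π * I * x) *
      (Complex.exp (π * I * τ + 2 * π * I * (x + y + (1 + τ) / 2)) *
        Complex.exp (-π * I * (2 * τ + 2 * (2 * x)))) = -Complex.exp (π * I * τ / 2 + 2 * π * I * y) := by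
    rw [← Complex.exp_add, ← Complex.exp_add, ← mul_neg_one (Complex.exp _), ← Complex.exp_pi_mul_I,
      ← Complex.exp_add]
    congr 1
    ring
  unfold theta1 thetaEven thetaOdd
  linear_combination (I ^ 2 * Complex.exp (π * I * τ / 4 + π * I * (x + y)) *
      Complex.exp (π * I * τ / 4 + π * I * (x - y))) * key +
    I ^ 2 * (jacobiTheta₂ (2 * x + τ) (2 * τ) * jacobiTheta₂ (2 * y) (2 * τ)) * hE +
    I ^ 2 * (Complex.exp (π * I * τ + 2 * π * I * (x + y + (1 + τ) / 2)) *
      Complex.exp (-π * I * (2 * τ + 2 * (2 * x)))) *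
      jacobiTheta₂ (2 * x) (2 * τ) * jacobiTheta₂ (2 * y + τ) (2 * τ) * hE +
    I ^ 2 * jacobiTheta₂ (2 * x) (2 * τ) * jacobiTheta₂ (2 * y + τ) (2 * τ) * hE2 +
    (jacobiTheta₂ (2 * x + τ) (2 * τ) * jacobiTheta₂ (2 * y) (2 * τ) *
      Complex.exp (π * I * τ / 2 + 2 * π * I * x)
     - Complex.exp (π * I * τ / 2 + 2 * π * I * y) *
        jacobiTheta₂ (2 * x) (2 * τ) * jacobiTheta₂ (2 * y + τ) (2 * τ)) * Complex.I_sq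

lemma differentiable_jacobiTheta₂_fst {τ : ℂ} (hτ : 0 < τ.im) :
    Differentiable ℂ fun z => jacobiTheta₂ z τ :=
  fun z => differentiableAt_jacobiTheta₂_fst z hτ

lemma differentiable_theta1 {τ : ℂ} (hτ : 0 < τ.im) : Differentiable ℂ (theta1 τ) := by
  have := (differentiable_jacobiTheta₂_fst hτ).comp
    (f := fun z : ℂ => z + (1 + τ) / 2) (by fun_prop)
  exact Differentiable.mul (by fun_prop) this

lemma differentiable_thetaEven {τ : ℂ} (hτ : 0 < τ.im) : Differentiable ℂ (thetaEven τ) :=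
  (differentiable_jacobiTheta₂_fst (by simpa using hτ)).comp (f := fun z : ℂ => 2 * z)
    (by fun_prop)

lemma differentiable_thetaOdd {τ : ℂ} (hτ : 0 < τ.im) : Differentiable ℂ (thetaOdd τ) := by
  have := (differentiable_jacobiTheta₂_fst (τ := 2 * τ) (by simpa using hτ)).comp
    (f := fun z : ℂ => 2 * z + τ) (by fun_prop)
  exact Differentiable.mul (by fun_prop) this

lemma two_mul_wronskian_theta1 {τ : ℂ} (hτ : 0 < τ.im) (x : ℂ) :
    2 * (deriv (deriv (theta1 τ)) x * theta1 τ x - deriv (theta1 τ) x ^ 2) =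
      thetaEven τ x * deriv (deriv (thetaOdd τ)) 0 -
        thetaOdd τ x * deriv (deriv (thetaEven τ)) 0 := by
  have hf := differentiable_theta1 hτ
  have hf' := hf.deriv
  have hA := differentiable_thetaEven hτ
  have hB := differentiable_thetaOdd hτ
  have hadd : ∀ {g : ℂ → ℂ}, Differentiable ℂ g → ∀ y,
      HasDerivAt (fun y => g (x + y)) (deriv g (x + y)) y :=
    fun hg y => (hg (x + y)).hasDerivAt.comp_const_add x y
  have hsub : ∀ {g : ℂ → ℂ}, Differentiable ℂ g → ∀ y,
      HasDerivAt (fun y => g (x - y)) (-deriv g (x - y)) y :=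
    fun hg y => (hg (x - y)).hasDerivAt.comp_const_sub x y
  have h1 : ∀ y, deriv (theta1 τ) (x + y) * theta1 τ (x - y) +
      theta1 τ (x + y) * -deriv (theta1 τ) (x - y) =
      thetaEven τ x * deriv (thetaOdd τ) y - thetaOdd τ x * deriv (thetaEven τ) y := by
    intro y
    refine ((hadd hf y).mul (hsub hf y)).unique ?_
    have h := ((hB y).hasDerivAt.const_mul (thetaEven τ x)).sub
      ((hA y).hasDerivAt.const_mul (thetaOdd τ x))
    exact h.congr_of_eventuallyEq
      (Filter.Eventually.of_forall fun y => theta1_add_mul_theta1_sub hτ x y)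
  have h2 := (((hadd hf' 0).mul (hsub hf 0)).add ((hadd hf 0).mul (hsub hf' 0).neg)).unique
    ((((hB.deriv 0).hasDerivAt.const_mul (thetaEven τ x)).sub
      ((hA.deriv 0).hasDerivAt.const_mul (thetaOdd τ x))).congr_of_eventuallyEq
      (Filter.Eventually.of_forall h1))
  simp only [Pi.neg_apply, add_zero, sub_zero, neg_neg] at h2
  linear_combination h2

lemma theta1_zero {τ : ℂ} (hτ : 0 < τ.im) : theta1 τ 0 = 0 := by
  have h := theta1_add_mul_theta1_sub hτ 0 0
  rw [add_zero, sub_zero, mul_comm (thetaOdd τ 0), sub_self] at h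
  exact mul_self_eq_zero.1 h

lemma theta1_neg (τ u : ℂ) : theta1 τ (-u) = -theta1 τ u := by
  unfold theta1
  have e : -u + (1 + τ) / 2 = -(u + (1 + τ) / 2) + τ + 1 := by ring
  rw [e, jacobiTheta₂_add_left, jacobiTheta₂_add_left', jacobiTheta₂_neg_left]
  have hE : Complex.exp (π * I * τ / 4 + π * I * -u) *
      Complex.exp (-π * I * (τ + 2 * -(u + (1 + τ) / 2))) = -Complex.exp (π * I * τ / 4 + π * I * u) := by
    rw [← Complex.exp_add, ← mul_neg_one (Complex.exp _), ← Complex.exp_pi_mul_I, ← Complex.exp_add]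
    congr 1
    ring
  linear_combination -I * jacobiTheta₂ (u + (1 + τ) / 2) τ * hE

lemma theta1_add_one (τ z : ℂ) : theta1 τ (z + 1) = -theta1 τ z := by
  unfold theta1
  have e : z + 1 + (1 + τ) / 2 = z + (1 + τ) / 2 + 1 := by ring
  have hE : Complex.exp (π * I * τ / 4 + π * I * (z + 1)) = -Complex.exp (π * I * τ / 4 + π * I * z) := by
    rw [← mul_neg_one (Complex.exp _), ← Complex.exp_pi_mul_I, ← Complex.exp_add]
    congr 1
    ring
  rw [e, jacobiTheta₂_add_left, hE]
  ring

lemma deriv_theta1_add_one (τ z : ℂ) : deriv (theta1 τ) (z + 1) = -deriv (theta1 τ) z := by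
  rw [← deriv_comp_add_const, ← deriv.fun_neg]
  congr 1
  exact funext (theta1_add_one τ)

/-- The product formula expressing the difference of two values of `wp`. -/
lemma theta1_mul_theta1_div_eq_wp_sub {τ : ℂ} (hτ : 0 < τ.im) {p u : ℂ}
    (hp : theta1 τ p ≠ 0) (hu : theta1 τ u ≠ 0) :
    theta1 τ (p + u) * theta1 τ (p - u) * deriv (theta1 τ) 0 ^ 2 /
      (theta1 τ p ^ 2 * theta1 τ u ^ 2) = wp τ p - wp τ u := by
  have h0 := two_mul_wronskian_theta1 hτ 0
  have hsq : ∀ x, theta1 τ x ^ 2 =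
      thetaEven τ x * thetaOdd τ 0 - thetaOdd τ x * thetaEven τ 0 := fun x => by
    simpa [sq] using theta1_add_mul_theta1_sub hτ x 0
  rw [theta1_zero hτ, mul_zero, zero_sub] at h0
  rw [wp, wp, div_sub_div _ _ (pow_ne_zero 2 hp) (pow_ne_zero 2 hu)]
  congr 1
  rw [theta1_add_mul_theta1_sub hτ, hsq p, hsq u]
  linear_combination -(thetaEven τ p * thetaOdd τ u - thetaOdd τ p * thetaEven τ u) / 2 * h0 -
    (thetaEven τ u * thetaOdd τ 0 - thetaOdd τ u * thetaEven τ 0) / 2 *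
      two_mul_wronskian_theta1 hτ p +
    (thetaEven τ p * thetaOdd τ 0 - thetaOdd τ p * thetaEven τ 0) / 2 *
      two_mul_wronskian_theta1 hτ u

lemma hasDerivAt_logDeriv_theta1 {τ : ℂ} (hτ : 0 < τ.im) {z : ℂ} (hz : theta1 τ z ≠ 0) :
    HasDerivAt (fun z => deriv (theta1 τ) z / theta1 τ z) (wp τ z) z := by
  have hf := differentiable_theta1 hτ
  have h := (hf.deriv z).hasDerivAt.div (hf z).hasDerivAt hz
  rwa [← sq] at h

lemma continuousAt_wp {τ : ℂ} (hτ : 0 < τ.im) {z : ℂ} (hz : theta1 τ z ≠ 0) :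
    ContinuousAt (wp τ) z := by
  have hf := differentiable_theta1 hτ
  have h0 := hf.continuous.continuousAt (x := z)
  have h1 := hf.deriv.continuous.continuousAt (x := z)
  have h2 := hf.deriv.deriv.continuous.continuousAt (x := z)
  exact ((h2.mul h0).sub (h1.pow 2)).div (h0.pow 2) (pow_ne_zero 2 hz)

lemma intervalIntegrable_wp {τ : ℂ} (hτ : 0 < τ.im) {c : ℂ}
    (hc : ∀ s : ℝ, s ∈ Set.Icc (0 : ℝ) 1 → theta1 τ (c + s) ≠ 0) :
    IntervalIntegrable (fun s : ℝ => wp τ (c + s)) MeasureTheory.volume 0 1 := by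
  refine ContinuousOn.intervalIntegrable fun s hs => ContinuousAt.continuousWithinAt ?_
  rw [Set.uIcc_of_le zero_le_one] at hs
  exact ContinuousAt.comp (f := fun s : ℝ => c + (s : ℂ)) (continuousAt_wp hτ (hc s hs))
    (by fun_prop)

lemma integral_wp_eq_zero {τ : ℂ} (hτ : 0 < τ.im) {c : ℂ}
    (hc : ∀ s : ℝ, s ∈ Set.Icc (0 : ℝ) 1 → theta1 τ (c + s) ≠ 0) :
    ∫ s in (0 : ℝ)..1, wp τ (c + s) = 0 := by
  rw [intervalIntegral.integral_eq_sub_of_hasDerivAt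
    (f := fun s : ℝ => deriv (theta1 τ) (c + s) / theta1 τ (c + s)) ?_
    (intervalIntegrable_wp hτ hc)]
  · simp [theta1_add_one, deriv_theta1_add_one]
  · intro s hs
    rw [Set.uIcc_of_le zero_le_one] at hs
    exact ((hasDerivAt_logDeriv_theta1 hτ (hc s hs)).comp_const_add c (s : ℂ)).comp_ofReal

lemma trace_PhiEll_mul_self {τ : ℂ} {n : ℕ} {κ t : Fin n → ℂ}
    {C H : Matrix (Fin n) (Fin n) ℂ} (hH : IsUnit H) {p : ℂ}
    (hpt : ∀ a, theta1 τ (p - t a) ≠ 0) (ht : ∀ a, theta1 τ (t a) ≠ 0) :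
    (PhiEll τ n κ t C H p * PhiEll τ n κ t C H p).trace =
      ∑ a, κ a ^ 2 + ∑ a, ∑ b, FMat τ n t C p a b * FMat τ n t C p b a := by
  set d : Fin n → ℂ := fun a => theta1 τ (p - t a) / theta1 τ (t a)
  have hd : ∀ a, d a ≠ 0 := fun a => div_ne_zero (hpt a) (ht a)
  have hinv : (ThetaDiag τ n t p)⁻¹ = Matrix.diagonal fun a => (d a)⁻¹ := by
    refine Matrix.inv_eq_right_inv ?_
    rw [ThetaDiag, Matrix.diagonal_mul_diagonal, ← Matrix.diagonal_one]
    exact congrArg _ (funext fun a => mul_inv_cancel₀ (hd a))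
  have hHH : H * H⁻¹ = 1 := Matrix.mul_nonsing_inv H ((Matrix.isUnit_iff_isUnit_det H).1 hH)
  set F := FMat τ n t C p with hF
  have hFd : ∀ a, F a a = 0 := fun a => by simp [hF, FMat]
  set M := Matrix.diagonal κ + ThetaDiag τ n t p * F * (ThetaDiag τ n t p)⁻¹ with hM
  have hMe : ∀ a b, M a b = Matrix.diagonal κ a b + d a * F a b * (d b)⁻¹ := fun a b => by
    rw [hM, hinv, Matrix.add_apply, Matrix.mul_diagonal, ThetaDiag, Matrix.diagonal_mul]
  have hconj : (PhiEll τ n κ t C H p * PhiEll τ n κ t C H p).trace = (M * M).trace := by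
    have : PhiEll τ n κ t C H p * PhiEll τ n κ t C H p = H⁻¹ * (M * M * H) := by
      calc _ = H⁻¹ * M * (H * H⁻¹) * M * H := by simp only [PhiEll, hM, hF, Matrix.mul_assoc]
        _ = _ := by rw [hHH]; simp only [Matrix.mul_assoc, Matrix.one_mul]
    rw [this, Matrix.trace_mul_comm, Matrix.mul_assoc, hHH, Matrix.mul_one]
  rw [hconj, Matrix.trace, ← Finset.sum_add_distrib]
  refine Finset.sum_congr rfl fun a _ => ?_
  rw [Matrix.diag_apply, Matrix.mul_apply]
  have hterm : ∀ b, M a b * M b a = (if a = b then κ a ^ 2 else 0) + F a b * F b a := by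
    intro b
    rw [hMe, hMe]
    rcases eq_or_ne a b with rfl | hab
    · simp [hFd, sq]
    · rw [Matrix.diagonal_apply_ne _ hab, Matrix.diagonal_apply_ne _ hab.symm, if_neg hab]
      have := hd a
      have := hd b
      field_simp
      ring
  simp [hterm, Finset.sum_add_distrib]

lemma FMat_mul_FMat {τ : ℂ} (hτ : 0 < τ.im) {n : ℕ} {t : Fin n → ℂ}
    {C : Matrix (Fin n) (Fin n) ℂ} {p : ℂ} (hp : theta1 τ p ≠ 0)
    (htt : ∀ a b, a ≠ b → theta1 τ (t a - t b) ≠ 0) (a b : Fin n) :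
    FMat τ n t C p a b * FMat τ n t C p b a =
      if a = b then 0 else C a b * C b a * (wp τ (t a - t b) - wp τ p) := by
  rcases eq_or_ne a b with rfl | hab
  · simp [FMat]
  have hu := htt a b hab
  have h := theta1_mul_theta1_div_eq_wp_sub hτ hp hu
  simp only [FMat, Matrix.of_apply, if_neg hab, if_neg hab.symm]
  have e1 : p + t a - t b = p + (t a - t b) := by ring
  have e2 : p + t b - t a = p - (t a - t b) := by ring
  have e3 : theta1 τ (t b - t a) = -theta1 τ (t a - t b) := by rw [← theta1_neg, neg_sub]
  rw [← neg_sub (wp τ p), ← h, e1, e2, e3]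
  field_simp

/-- The Hitchin Hamiltonian in the elliptic case: integrating `(1/2) Tr Φ²` over the
A-cycle, represented by the horizontal segment from `c` to `c+1`, gives
`(1/2) Σ κ_a² + (1/2) Σ_{a≠b} C_{ab}C_{ba} ℘(t_a - t_b)`. -/
theorem hitchin_hamiltonian_eCM (τ : ℂ) (hτ : 0 < τ.im) (n : ℕ) (hn : 1 ≤ n)
    (κ t : Fin n → ℂ) (C H : Matrix (Fin n) (Fin n) ℂ)
    (hC : ∀ a, C a a = 0) (hH : IsUnit H) (c : ℂ)
    (hc : ∀ s : ℝ, s ∈ Set.Icc (0 : ℝ) 1 → theta1 τ (c + s) ≠ 0)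
    (hct : ∀ s : ℝ, s ∈ Set.Icc (0 : ℝ) 1 → ∀ a, theta1 τ (c + s - t a) ≠ 0)
    (ht : ∀ a, theta1 τ (t a) ≠ 0)
    (htt : ∀ a b, a ≠ b → theta1 τ (t a - t b) ≠ 0) :
    (1 / 2 : ℂ) * ∫ s in (0 : ℝ)..1,
        (PhiEll τ n κ t C H (c + s) * PhiEll τ n κ t C H (c + s)).trace =
      (1 / 2 : ℂ) * (∑ a, κ a ^ 2) +
        (1 / 2 : ℂ) * ∑ a, ∑ b, (if a = b then 0 else C a b * C b a * wp τ (t a - t b)) := by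
  have hI := intervalIntegrable_wp hτ hc
  have hterm : ∀ a b : Fin n, (fun s : ℝ => if a = b then (0 : ℂ) else
      C a b * C b a * (wp τ (t a - t b) - wp τ (c + s))) = fun s : ℝ =>
      (if a = b then 0 else C a b * C b a) * (wp τ (t a - t b) - wp τ (c + s)) := by
    intro a b
    split_ifs <;> simp
  have hint : ∀ a b : Fin n, IntervalIntegrable (fun s : ℝ => if a = b then (0 : ℂ) else
      C a b * C b a * (wp τ (t a - t b) - wp τ (c + s))) MeasureTheory.volume 0 1 := by
    intro a b
    rw [hterm]
    exact (intervalIntegrable_const.sub hI).const_mul _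
  have hval : ∀ a b : Fin n, ∫ s in (0 : ℝ)..1, (if a = b then (0 : ℂ) else
      C a b * C b a * (wp τ (t a - t b) - wp τ (c + s))) =
      if a = b then 0 else C a b * C b a * wp τ (t a - t b) := by
    intro a b
    rw [hterm, intervalIntegral.integral_const_mul,
      intervalIntegral.integral_sub intervalIntegrable_const hI, integral_wp_eq_zero hτ hc]
    simp
  have hcongr : ∀ s ∈ Set.uIcc (0 : ℝ) 1,
      (PhiEll τ n κ t C H (c + s) * PhiEll τ n κ t C H (c + s)).trace =
        ∑ a, κ a ^ 2 + ∑ a, ∑ b, if a = b then (0 : ℂ) else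
          C a b * C b a * (wp τ (t a - t b) - wp τ (c + s)) := by
    intro s hs
    rw [Set.uIcc_of_le zero_le_one] at hs
    rw [trace_PhiEll_mul_self hH (hct s hs) ht]
    simp only [FMat_mul_FMat hτ (hc s hs) htt]
  have hsum : ∀ a : Fin n, IntervalIntegrable (fun s : ℝ => ∑ b, if a = b then (0 : ℂ) else
      C a b * C b a * (wp τ (t a - t b) - wp τ (c + s))) MeasureTheory.volume 0 1 := by
    intro a
    simpa only [Finset.sum_fn] using IntervalIntegrable.sum Finset.univ fun b _ => hint a b
  have hsum' : IntervalIntegrable (fun s : ℝ => ∑ a, ∑ b, if a = b then (0 : ℂ) else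
      C a b * C b a * (wp τ (t a - t b) - wp τ (c + s))) MeasureTheory.volume 0 1 := by
    simpa only [Finset.sum_fn] using IntervalIntegrable.sum Finset.univ fun a _ => hsum a
  rw [intervalIntegral.integral_congr hcongr,
    intervalIntegral.integral_add intervalIntegrable_const hsum',
    intervalIntegral.integral_finsetSum fun a _ => hsum a,
    Finset.sum_congr rfl fun a _ => intervalIntegral.integral_finsetSum fun b _ => hint a b]
  simp only [hval]
  simp [mul_add]
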